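/- Let H(q,p) = ½ pᵀ M(q)⁻¹ p + V(q) be the Hamiltonian of an n-degree-of-freedom conservative mechanical system, with M smooth, symmetric positive definite valued and V smooth, and assume the associated Hamiltonian vector field is continuously differentiable (so solutions of initial value problems are unique). If q, p : ℝ → ℝⁿ solve Hamilton's equations q' = ∂H/∂p, p' = −∂H/∂q and there exist times t₁ ≠ t₂ with p(t₁) = 0 and p(t₂) = 0 and q(t₁) ≠ q(t₂), then the trajectory is periodic with period T = 2|t₁ − t₂|, i.e. q(t + 2|t₁−t₂|) = q(t) and p(t + 2|t₁−t₂|) = p(t) for all t ∈ ℝ. -/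

import Mathlib

open Matrix

/-- The vector of partial derivatives of `f` at `x` (the gradient in coordinates). -/
noncomputable def pderivVec {n : ℕ} (f : (Fin n → ℝ) → ℝ) (x : Fin n → ℝ) : Fin n → ℝ :=
  fun i => fderiv ℝ f x (Pi.single i 1)

/-- Two global integral curves of a `C¹` vector field that meet at some time are equal. -/
theorem ContDiff.integralCurve_unique {E : Type*} [NormedAddCommGroup E] [NormedSpace ℝ E]
    {X : E → E} (hX : ContDiff ℝ 1 X) {f g : ℝ → E}
    (hf : ∀ t, HasDerivAt f (X (f t)) t) (hg : ∀ t, HasDerivAt g (X (g t)) t)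
    {t₀ : ℝ} (h₀ : f t₀ = g t₀) : f = g := by
  have hfc : Continuous f := continuous_iff_continuousAt.2 fun t => (hf t).continuousAt
  have hgc : Continuous g := continuous_iff_continuousAt.2 fun t => (hg t).continuousAt
  have hclopen : IsClopen {t | f t = g t} := by
    refine ⟨isClosed_eq hfc hgc, isOpen_iff_mem_nhds.2 fun t (ht : f t = g t) => ?_⟩
    obtain ⟨K, s, hs, hK⟩ := (hX.contDiffAt (x := f t)).exists_lipschitzOnWith
    exact ODE_solution_unique_of_eventually (v := fun _ => X) (s := fun _ => s)
      (.of_forall fun _ => hK)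
      ((hfc.continuousAt.eventually_mem hs).mono fun t ht => ⟨hf t, ht⟩)
      ((hgc.continuousAt.eventually_mem (ht ▸ hs)).mono fun t ht => ⟨hg t, ht⟩) ht
  exact funext fun t => (hclopen.eq_univ ⟨t₀, h₀⟩).ge (Set.mem_univ t)

/-- If a linear map `R` reverses a `C¹` vector field, then an integral curve meeting the fixed
space of `R` at time `t₀` is mapped by `R` to its time reversal about `t₀`. -/
theorem ContDiff.integralCurve_reflect {E : Type*} [NormedAddCommGroup E] [NormedSpace ℝ E]
    {X : E → E} (hX : ContDiff ℝ 1 X) {R : E →L[ℝ] E} (hR : ∀ x, X (R x) = -R (X x))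
    {f : ℝ → E} (hf : ∀ t, HasDerivAt f (X (f t)) t) {t₀ : ℝ} (h₀ : R (f t₀) = f t₀) (t : ℝ) :
    R (f (2 * t₀ - t)) = f t := by
  refine congrFun (hX.integralCurve_unique (f := fun t => R (f (2 * t₀ - t)))
    (fun t => ?_) hf (t₀ := t₀) ?_) t
  · rw [hR, ← map_neg]
    exact R.hasFDerivAt.comp_hasDerivAt t ((hf _).comp_const_sub (2 * t₀) t)
  · simpa [two_mul] using h₀

/-- The gradient of an even function is odd. -/
theorem pderivVec_neg_of_even {n : ℕ} {f : (Fin n → ℝ) → ℝ} (hf : ∀ x, f (-x) = f x)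
    (x : Fin n → ℝ) : pderivVec f (-x) = -pderivVec f x := by
  have h := (ContinuousLinearEquiv.neg ℝ (M := Fin n → ℝ)).comp_right_fderiv (f := f) (x := x)
  have hcomp : f ∘ ContinuousLinearEquiv.neg ℝ (M := Fin n → ℝ) = f := funext hf
  rw [hcomp] at h
  funext i
  simp [pderivVec, h]

/-- Lemma 3: a solution of Hamilton's equations for the mechanical Hamiltonian
`H(q,p) = ½ pᵀ M(q)⁻¹ p + V(q)` passing through two distinct zero-momentum
configurations (`p(t₁) = 0`, `p(t₂) = 0`, `q(t₁) ≠ q(t₂)`, `t₁ ≠ t₂`) is periodic with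
period `T = 2|t₁ − t₂|`. -/
theorem two_rest_points_implies_periodic {n : ℕ}
    (M : (Fin n → ℝ) → Matrix (Fin n) (Fin n) ℝ)
    (hMsmooth : ∀ i j, ContDiff ℝ (⊤ : ℕ∞) fun q => M q i j)
    (hMsymm : ∀ q, (M q).IsSymm)
    (hMpd : ∀ q, (M q).PosDef)
    (V : (Fin n → ℝ) → ℝ) (hV : ContDiff ℝ (⊤ : ℕ∞) V)
    (H : (Fin n → ℝ) → (Fin n → ℝ) → ℝ)
    (hH : ∀ q p, H q p = (1 / 2 : ℝ) * (p ⬝ᵥ ((M q)⁻¹).mulVec p) + V q)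
    -- the Hamiltonian vector field is continuously differentiable
    (hX : ContDiff ℝ 1 (fun x : (Fin n → ℝ) × (Fin n → ℝ) =>
      (pderivVec (fun p' => H x.1 p') x.2, -pderivVec (fun q' => H q' x.2) x.1)))
    (q p : ℝ → Fin n → ℝ)
    (hq : ∀ t, HasDerivAt q (pderivVec (fun p' => H (q t) p') (p t)) t)
    (hp : ∀ t, HasDerivAt p (-pderivVec (fun q' => H q' (p t)) (q t)) t)
    (t₁ t₂ : ℝ) (ht : t₁ ≠ t₂)
    (hp1 : p t₁ = 0) (hp2 : p t₂ = 0) (hq12 : q t₁ ≠ q t₂) :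
    ∀ t : ℝ, q (t + 2 * |t₁ - t₂|) = q t ∧ p (t + 2 * |t₁ - t₂|) = p t := by
  have hHeven : ∀ q p, H q (-p) = H q p := fun q p => by simp [hH, mulVec_neg]
  set X : (Fin n → ℝ) × (Fin n → ℝ) → (Fin n → ℝ) × (Fin n → ℝ) := fun x =>
    (pderivVec (fun p' => H x.1 p') x.2, -pderivVec (fun q' => H q' x.2) x.1)
  let R : (Fin n → ℝ) × (Fin n → ℝ) →L[ℝ] (Fin n → ℝ) × (Fin n → ℝ) :=
    (ContinuousLinearMap.id ℝ _).prodMap (-ContinuousLinearMap.id ℝ _)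
  have hR : ∀ x, X (R x) = -R (X x) := fun x => by
    simp [X, R, hHeven, pderivVec_neg_of_even (hHeven x.1)]
  have hz : ∀ t, HasDerivAt (fun t => (q t, p t)) (X (q t, p t)) t :=
    fun t => (hq t).prodMk (hp t)
  have reflect : ∀ {s}, p s = 0 → ∀ t, q (2 * s - t) = q t ∧ -p (2 * s - t) = p t :=
    fun {s} hs t => Prod.ext_iff.1 (hX.integralCurve_reflect hR hz (t₀ := s) (by simp [R, hs]) t)
  have periodic : ∀ {a b}, p a = 0 → p b = 0 →
      ∀ t, q (t + 2 * (a - b)) = q t ∧ p (t + 2 * (a - b)) = p t := by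
    intro a b ha hb t
    obtain ⟨hqa, hpa⟩ := reflect ha (2 * b - t)
    obtain ⟨hqb, hpb⟩ := reflect hb t
    rw [show t + 2 * (a - b) = 2 * a - (2 * b - t) by ring]
    exact ⟨hqa.trans hqb, by rw [← hpb, ← hpa, neg_neg]⟩
  rcases abs_choice (t₁ - t₂) with h | h <;> rw [h]
  · exact periodic hp1 hp2
  · rw [neg_sub]
    exact periodic hp2 hp1
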